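/- Suppose K₀, K₁, K₂ are ℍ-hulls with K₀ ⊂ K₁ ∩ K₂. Then hcap(K₁) + hcap(K₂) ≥ hcap(Hull(K₁ ∪ K₂)) + hcap(K₀). -/

import Mathlib

open Complex Filter Set Metric Bornology Topology

noncomputable section

/-- The open upper half-plane `ℍ`. -/
def UHP : Set ℂ := {z : ℂ | 0 < z.im}

/-- `K^doub`: the closure of `K` together with its reflection across `ℝ`. -/
def Kdoub (K : Set ℂ) : Set ℂ := closure K ∪ (starRingEnd ℂ) '' closure K

/-- `a_K = min (cl K ∩ ℝ)`. -/
def aK (K : Set ℂ) : ℝ := sInf {x : ℝ | (x : ℂ) ∈ closure K}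

/-- `b_K = max (cl K ∩ ℝ)`. -/
def bK (K : Set ℂ) : ℝ := sSup {x : ℝ | (x : ℂ) ∈ closure K}

/-- The segment `[a_K, b_K]` regarded as a subset of `ℂ`. -/
def seg (K : Set ℂ) : Set ℂ := (fun t : ℝ => (t : ℂ)) '' Set.Icc (aK K) (bK K)

/-- `K` is an `ℍ`-hull with mapping-out function `g` (normalized hydrodynamically at `∞`),
whose Schwarz reflection maps the complement of `K^doub ∪ [a_K, b_K]` onto `ℂ \ S_K`
for the compact set `S = S_K ⊆ ℝ`. -/
structure IsHullMap (K : Set ℂ) (g : ℂ → ℂ) (S : Set ℝ) : Prop where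
  subset_UHP : K ⊆ UHP
  bounded : IsBounded K
  relClosed : ∀ z ∈ closure K, 0 < z.im → z ∈ K
  holo : DifferentiableOn ℂ g (UHP \ K)
  bij : Set.BijOn g (UHP \ K) UHP
  hydro : Tendsto (fun z => g z - z) (Bornology.cobounded ℂ) (nhds 0)
  compactS : IsCompact S
  ext_holo : K.Nonempty → DifferentiableOn ℂ g {z : ℂ | z ∉ Kdoub K}
  real_vals : K.Nonempty → ∀ x : ℝ, (x : ℂ) ∉ Kdoub K → (g (x : ℂ)).im = 0
  conj_symm : K.Nonempty → ∀ z : ℂ, z ∉ Kdoub K → g ((starRingEnd ℂ) z) = (starRingEnd ℂ) (g z)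
  extBij : K.Nonempty →
    Set.BijOn g {z : ℂ | z ∉ Kdoub K ∧ z ∉ seg K} {z : ℂ | ∀ s ∈ S, z ≠ (s : ℂ)}

/-- `g` has half-plane capacity `c` : `g z = z + c / z + O(1/z²)` near `∞`. -/
def HasHcap (g : ℂ → ℂ) (c : ℝ) : Prop :=
  Tendsto (fun z : ℂ => z * (g z - z)) (Bornology.cobounded ℂ) (nhds (c : ℂ))

theorem isOpen_UHP : IsOpen UHP := isOpen_lt continuous_const Complex.continuous_im

theorem tendsto_ofReal_mul_I_cobounded :
    Tendsto (fun y : ℝ => (y * I : ℂ)) atTop (cobounded ℂ) := by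
  rw [← tendsto_norm_atTop_iff_cobounded]
  simpa using tendsto_abs_atTop_atTop

/-- Maximum principle for the imaginary part of a holomorphic function on an open set, with
`limsup` boundary conditions at the finite boundary points and at `∞`. -/
theorem im_nonpos_of_boundary {D : Set ℂ} (hD : IsOpen D) {F : ℂ → ℂ}
    (hF : DifferentiableOn ℂ F D)
    (hbd : ∀ ζ ∉ D, ∀ ε > 0, ∀ᶠ z in 𝓝[D] ζ, (F z).im < ε)
    (hinf : Tendsto F (cobounded ℂ) (𝓝 0)) :
    ∀ z ∈ D, (F z).im ≤ 0 := by
  intro z hz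
  by_contra! hm
  set m := (F z).im
  set U : Set ℂ := {w | w ∈ D ∧ m / 2 < (F w).im}
  have him : ContinuousOn (fun w => (F w).im) D :=
    Complex.continuous_im.comp_continuousOn hF.continuousOn
  have hUo : IsOpen U := him.isOpen_inter_preimage hD isOpen_Ioi
  have hUD : U ⊆ D := fun w hw => hw.1
  have hclD : closure U ⊆ D := by
    intro ζ hζ
    by_contra hζD
    have h1 : ∃ᶠ w in 𝓝 ζ, w ∈ U := mem_closure_iff_frequently.1 hζ
    have h2 := eventually_nhdsWithin_iff.1 (hbd ζ hζD (m / 2) (by linarith))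
    obtain ⟨w, hw, hw'⟩ := (h1.and_eventually h2).exists
    exact absurd (hw' hw.1) (not_lt.2 hw.2.le)
  have hUb : IsBounded U := by
    have h1 : ∀ᶠ w in cobounded ℂ, (F w).im < m / 2 :=
      ((Complex.continuous_im.tendsto 0).comp hinf).eventually_lt_const (by simpa using hm)
    rw [← isCobounded_compl_iff]
    exact mem_of_superset h1 fun w hw hwU => absurd hwU.2 (not_lt.2 (le_of_lt hw))
  have hnorm : ∀ w, ‖Complex.exp (-I * F w)‖ = Real.exp (F w).im := by
    intro w; simp [Complex.norm_exp]
  have hdiff : DiffContOnCl ℂ (fun w => Complex.exp (-I * F w)) U :=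
    ((hF.const_mul _).cexp.mono hclD).diffContOnCl
  have key := Complex.norm_le_of_forall_mem_frontier_norm_le hUb hdiff (C := Real.exp (m / 2))
    (fun ζ hζ => by
      rw [hnorm, Real.exp_le_exp]
      by_contra! h
      rw [hUo.frontier_eq] at hζ
      exact hζ.2 ⟨hclD hζ.1, h⟩)
    (subset_closure (show z ∈ U from ⟨hz, by linarith⟩))
  rw [hnorm, Real.exp_le_exp] at key
  linarith

theorem isPreconnected_UHP_diff_closedBall {R : ℝ} (hR : 0 < R) :
    IsPreconnected {w : ℂ | 0 < w.im ∧ R < ‖w‖} := by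
  have hS : IsPreconnected (Set.Ioi (Real.log R) ×ℂ Set.Ioo 0 Real.pi) :=
    (((convex_Ioi _).linear_preimage reLm).inter
      ((convex_Ioo _ _).linear_preimage imLm)).isPreconnected
  convert hS.image Complex.exp Complex.continuous_exp.continuousOn using 1
  ext w
  constructor
  · rintro ⟨h1, h2⟩
    have h0 : w ≠ 0 := by rintro rfl; simp at h1
    refine ⟨Complex.log w, ⟨?_, ?_, ?_⟩, Complex.exp_log h0⟩
    · simpa [Complex.log_re] using Real.log_lt_log hR h2
    · rw [Complex.log_im]
      refine lt_of_le_of_ne (Complex.arg_nonneg_iff.2 h1.le) fun h => ?_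
      have := (Complex.arg_eq_zero_iff.1 h.symm).2
      linarith
    · rw [Complex.log_im]
      exact Complex.arg_lt_pi_iff.2 (Or.inr h1.ne')
  · rintro ⟨z, ⟨h1, h2, h3⟩, rfl⟩
    refine ⟨?_, ?_⟩
    · rw [Complex.exp_im]
      exact mul_pos (Real.exp_pos _) (Real.sin_pos_of_pos_of_lt_pi h2 h3)
    · rw [Complex.norm_exp]
      exact (Real.log_lt_iff_lt_exp hR).1 h1

/-- Injective holomorphic functions are open at every point. -/
theorem nhds_le_map_nhds_of_injOn {D : Set ℂ} (hD : IsOpen D) {g : ℂ → ℂ}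
    (hg : DifferentiableOn ℂ g D) (hinj : InjOn g D) {z : ℂ} (hz : z ∈ D) :
    𝓝 (g z) ≤ map g (𝓝 z) := by
  refine (hg.analyticAt (hD.mem_nhds hz)).eventually_constant_or_nhds_le_map_nhds.resolve_left ?_
  intro h
  have h1 : ∀ᶠ w in 𝓝[≠] z, g w = g z ∧ w ∈ D :=
    (h.and (hD.mem_nhds hz)).filter_mono nhdsWithin_le_nhds
  obtain ⟨w, ⟨hw, hwD⟩, hwz⟩ := (h1.and self_mem_nhdsWithin).exists
  exact hwz (hinj hwD hz hw)

theorem isOpen_image_of_injOn {D : Set ℂ} (hD : IsOpen D) {g : ℂ → ℂ}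
    (hg : DifferentiableOn ℂ g D) (hinj : InjOn g D) {V : Set ℂ} (hV : IsOpen V) (hVD : V ⊆ D) :
    IsOpen (g '' V) := by
  rw [isOpen_iff_mem_nhds]
  rintro _ ⟨z, hz, rfl⟩
  exact nhds_le_map_nhds_of_injOn hD hg hinj (hVD hz) (image_mem_map (hV.mem_nhds hz))

namespace IsHullMap

variable {K : Set ℂ} {g : ℂ → ℂ} {S : Set ℝ}

theorem isOpen_diff (h : IsHullMap K g S) : IsOpen (UHP \ K) := by
  have : UHP \ K = UHP \ closure K :=
    Set.ext fun z => and_congr_right fun hz => not_congr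
      ⟨fun hk => subset_closure hk, fun hk => h.relClosed z hk hz⟩
  rw [this]
  exact isOpen_UHP.sdiff isClosed_closure

theorem im_pos (h : IsHullMap K g S) {z : ℂ} (hz : z ∈ UHP \ K) : 0 < (g z).im :=
  h.bij.mapsTo hz

theorem eventually_mem_diff (h : IsHullMap K g S) :
    ∀ᶠ y : ℝ in atTop, (y * I : ℂ) ∈ UHP \ K := by
  have h1 : ∀ᶠ z in cobounded ℂ, z ∉ K := h.bounded.compl
  filter_upwards [tendsto_ofReal_mul_I_cobounded.eventually h1, eventually_gt_atTop 0] with y hy hy0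
  exact ⟨by simpa [UHP] using hy0, hy⟩

/-- A mapping-out function is bounded on bounded sets. -/
theorem exists_norm_le (h : IsHullMap K g S) (r : ℝ) :
    ∃ M, ∀ z ∈ UHP \ K, ‖z‖ < r → ‖g z‖ ≤ M := by
  have h1 : ∀ᶠ z in cobounded ℂ, ‖g z - z‖ < 1 := by
    simpa using h.hydro.norm.eventually_lt_const (u := 1) (by simp)
  obtain ⟨R₀, hR₀⟩ := (hasBasis_cobounded_norm (E := ℂ)).eventually_iff.1 h1
  replace hR₀ := hR₀.2
  set R := max (max R₀ r) 1
  have hR : ∀ z : ℂ, R ≤ ‖z‖ → ‖g z - z‖ < 1 := fun z hz =>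
    hR₀ (((le_max_left _ _).trans (le_max_left _ _)).trans hz)
  have hR1 : 1 ≤ R := le_max_right _ _
  refine ⟨R + 1, fun z hz hzr => ?_⟩
  by_contra! hgz
  have hD := h.isOpen_diff
  have hopen := fun {V : Set ℂ} => isOpen_image_of_injOn hD h.holo h.bij.injOn (V := V)
  set V : Set ℂ := (UHP \ K) ∩ {z | ‖z‖ < R}
  set W : Set ℂ := (UHP \ K) ∩ {z | R < ‖z‖}
  have hVo : IsOpen (g '' V) :=
    hopen (hD.inter (isOpen_lt continuous_norm continuous_const)) inter_subset_left
  have hWo : IsOpen (g '' W) :=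
    hopen (hD.inter (isOpen_lt continuous_const continuous_norm)) inter_subset_left
  have hpre := isPreconnected_UHP_diff_closedBall (R := R + 1) (by linarith)
  have hcover : {w : ℂ | 0 < w.im ∧ R + 1 < ‖w‖} ⊆ g '' V ∪ g '' W := by
    rintro w ⟨hw1, hw2⟩
    obtain ⟨x, hx, rfl⟩ := h.bij.surjOn hw1
    rcases lt_trichotomy ‖x‖ R with hlt | heq | hgt
    · exact Or.inl ⟨x, ⟨hx, hlt⟩, rfl⟩
    · have h2 := hR x heq.ge
      have h3 := norm_add_le (g x - x) x
      rw [sub_add_cancel] at h3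
      linarith
    · exact Or.inr ⟨x, ⟨hx, hgt⟩, rfl⟩
  have hzV : z ∈ V := ⟨hz, hzr.trans_le ((le_max_right _ _).trans (le_max_left _ _))⟩
  obtain ⟨y, hyD, hy⟩ := (h.eventually_mem_diff.and (eventually_gt_atTop (R + 2))).exists
  have hny : ‖(y * I : ℂ)‖ = y := by
    simp only [norm_mul, norm_real, norm_I, mul_one, Real.norm_eq_abs]
    exact abs_of_pos (by linarith)
  have hgy : R + 1 < ‖g (y * I)‖ := by
    have h2 := hR (y * I) (by rw [hny]; linarith)
    have h3 := norm_sub_norm_le (y * I : ℂ) (g (y * I))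
    rw [norm_sub_rev, hny] at h3
    linarith
  obtain ⟨_, _, ⟨a, ha, rfl⟩, ⟨b, hb, hab⟩⟩ := hpre _ _ hVo hWo hcover
    ⟨g z, ⟨h.im_pos hz, hgz⟩, ⟨z, hzV, rfl⟩⟩
    ⟨g (y * I), ⟨h.im_pos hyD, hgy⟩, ⟨_, ⟨hyD, by rw [mem_ofPred_eq, hny]; linarith⟩, rfl⟩⟩
  have hlt : ‖a‖ < ‖b‖ := lt_trans ha.2 hb.2
  rw [h.bij.injOn hb.1 ha.1 hab] at hlt
  exact lt_irrefl _ hlt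

/-- The imaginary part of a mapping-out function vanishes at the boundary. -/
theorem eventually_im_lt (h : IsHullMap K g S) {ζ : ℂ} (hζ : ζ ∉ UHP \ K) {ε : ℝ} (hε : 0 < ε) :
    ∀ᶠ z in 𝓝[UHP \ K] ζ, (g z).im < ε := by
  obtain ⟨M, hM⟩ := h.exists_norm_le (‖ζ‖ + 1)
  set C : Set ℂ := closedBall 0 M ∩ {w | ε ≤ w.im}
  have hC : IsCompact C :=
    (isCompact_closedBall 0 M).inter_right (isClosed_le continuous_const Complex.continuous_im)
  have hCU : C ⊆ UHP := fun w hw => hε.trans_le hw.2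
  set f := Function.invFunOn g (UHP \ K)
  have hinv : InvOn f g (UHP \ K) UHP := h.bij.invOn_invFunOn
  have hf : MapsTo f UHP (UHP \ K) := h.bij.surjOn.mapsTo_invFunOn
  have hcont : ContinuousOn f UHP := by
    intro w hw
    refine ContinuousAt.continuousWithinAt ?_
    have h1 := nhds_le_map_nhds_of_injOn h.isOpen_diff h.holo h.bij.injOn (hf hw)
    rw [hinv.2 hw] at h1
    refine (map_mono h1).trans ?_
    rw [map_map]
    have h2 : f ∘ g =ᶠ[𝓝 (f w)] id :=
      mem_of_superset (h.isOpen_diff.mem_nhds (hf hw)) fun x hx => hinv.1 hx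
    exact (tendsto_id.congr' h2.symm : Tendsto (f ∘ g) (𝓝 (f w)) (𝓝 (f w)))
  have hfC : IsClosed (f '' C) := (hC.image_of_continuousOn (hcont.mono hCU)).isClosed
  have hζC : ζ ∉ f '' C := by
    rintro ⟨w, hw, rfl⟩
    exact hζ (hf (hCU hw))
  have hball : ∀ᶠ z in 𝓝 ζ, ‖z‖ < ‖ζ‖ + 1 :=
    continuous_norm.continuousAt.eventually_lt_const (by linarith)
  rw [eventually_nhdsWithin_iff]
  filter_upwards [hfC.isOpen_compl.mem_nhds hζC, hball] with z hz hzb hzD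
  by_contra! hzε
  exact hz ⟨g z, ⟨by simpa using hM z hzD hzb, hzε⟩, hinv.1 hzD⟩

/-- Larger hulls have mapping-out functions with smaller imaginary part. -/
theorem im_le_im (h : IsHullMap K g S) {K' : Set ℂ} {g' : ℂ → ℂ} {S' : Set ℝ}
    (h' : IsHullMap K' g' S') (hsub : K ⊆ K') {z : ℂ} (hz : z ∈ UHP \ K') :
    (g' z).im ≤ (g z).im := by
  have hD : UHP \ K' ⊆ UHP \ K := sdiff_subset_sdiff_right hsub
  have key := im_nonpos_of_boundary h'.isOpen_diff (F := fun z => g' z - g z)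
    (h'.holo.sub (h.holo.mono hD))
    (fun ζ hζ ε hε => by
      filter_upwards [h'.eventually_im_lt hζ hε, self_mem_nhdsWithin] with w hw hwD
      have := h.im_pos (hD hwD)
      rw [sub_im]
      linarith)
    (by simpa using h'.hydro.sub h.hydro) z hz
  rw [sub_im] at key
  linarith

end IsHullMap

/-- **Submodularity of half-plane capacity.** If `K₀ ⊆ K₁ ∩ K₂` are `ℍ`-hulls and `K₃` is the
hull generated by `K₁ ∪ K₂` (i.e. `ℍ \ K₃` is the unbounded connected component of
`ℍ \ cl(K₁ ∪ K₂)`), then `hcap K₁ + hcap K₂ ≥ hcap K₃ + hcap K₀`. -/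
theorem stmt_5 (K₀ K₁ K₂ K₃ : Set ℂ) (g₀ g₁ g₂ g₃ : ℂ → ℂ) (S₀ S₁ S₂ S₃ : Set ℝ)
    (c₀ c₁ c₂ c₃ : ℝ)
    (h₀ : IsHullMap K₀ g₀ S₀) (h₁ : IsHullMap K₁ g₁ S₁)
    (h₂ : IsHullMap K₂ g₂ S₂) (h₃ : IsHullMap K₃ g₃ S₃)
    (hc₀ : HasHcap g₀ c₀) (hc₁ : HasHcap g₁ c₁) (hc₂ : HasHcap g₂ c₂) (hc₃ : HasHcap g₃ c₃)
    (hsub : K₀ ⊆ K₁ ∩ K₂)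
    (hK₃sub : K₁ ∪ K₂ ⊆ K₃)
    (hK₃unbdd : ¬ IsBounded (UHP \ K₃))
    (hK₃comp : ∃ z₀ ∈ UHP \ closure (K₁ ∪ K₂),
      UHP \ K₃ = connectedComponentIn (UHP \ closure (K₁ ∪ K₂)) z₀) :
    c₃ + c₀ ≤ c₁ + c₂ := by
  have h01 : K₀ ⊆ K₁ := fun z hz => (hsub hz).1
  have h02 : K₀ ⊆ K₂ := fun z hz => (hsub hz).2
  have hD1 : UHP \ K₃ ⊆ UHP \ K₁ := sdiff_subset_sdiff_right (subset_union_left.trans hK₃sub)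
  have hD2 : UHP \ K₃ ⊆ UHP \ K₂ := sdiff_subset_sdiff_right (subset_union_right.trans hK₃sub)
  have hD0 : UHP \ K₃ ⊆ UHP \ K₀ := hD1.trans (sdiff_subset_sdiff_right h01)
  have hfront : ∀ ζ ∈ closure (UHP \ K₃), ζ ∉ UHP \ K₃ → ζ ∉ UHP \ K₁ ∨ ζ ∉ UHP \ K₂ := by
    intro ζ hcl hζ
    by_contra! hcon
    obtain ⟨z₀, hz₀, heq⟩ := hK₃comp
    have hO : IsOpen (UHP \ closure (K₁ ∪ K₂)) := isOpen_UHP.sdiff isClosed_closure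
    have hζO : ζ ∈ UHP \ closure (K₁ ∪ K₂) := by
      refine ⟨hcon.1.1, fun hk => ?_⟩
      rw [closure_union] at hk
      exact hk.elim (fun hk => hcon.1.2 (h₁.relClosed ζ hk hcon.1.1))
        fun hk => hcon.2.2 (h₂.relClosed ζ hk hcon.1.1)
    have hcc : IsOpen (connectedComponentIn (UHP \ closure (K₁ ∪ K₂)) ζ) :=
      hO.connectedComponentIn
    obtain ⟨w, hw1, hw2⟩ := mem_closure_iff.1 hcl _ hcc (mem_connectedComponentIn hζO)
    rw [heq] at hw2 hζ
    rw [connectedComponentIn_eq hw2, ← connectedComponentIn_eq hw1] at hζ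
    exact hζ (mem_connectedComponentIn hζO)
  have key : ∀ z ∈ UHP \ K₃, (g₁ z + g₂ z - g₃ z - g₀ z).im ≤ 0 := by
    refine im_nonpos_of_boundary h₃.isOpen_diff
      ((((h₁.holo.mono hD1).add (h₂.holo.mono hD2)).sub h₃.holo).sub (h₀.holo.mono hD0)) ?_ ?_
    · intro ζ hζ ε hε
      by_cases hcl : ζ ∈ closure (UHP \ K₃)
      · rcases hfront ζ hcl hζ with hb | hb
        · filter_upwards [(h₁.eventually_im_lt hb hε).filter_mono (nhdsWithin_mono _ hD1),
            self_mem_nhdsWithin] with z hz hzD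
          have := h₀.im_le_im h₂ h02 (hD2 hzD)
          have := h₃.im_pos hzD
          simp only [sub_im, add_im]
          linarith
        · filter_upwards [(h₂.eventually_im_lt hb hε).filter_mono (nhdsWithin_mono _ hD2),
            self_mem_nhdsWithin] with z hz hzD
          have := h₀.im_le_im h₁ h01 (hD1 hzD)
          have := h₃.im_pos hzD
          simp only [sub_im, add_im]
          linarith
      · rw [notMem_closure_iff_nhdsWithin_eq_bot.1 hcl]
        exact eventually_bot
    · have := ((h₁.hydro.add h₂.hydro).sub h₃.hydro).sub h₀.hydro
      simp only [add_zero, sub_zero] at this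
      exact this.congr fun z => by ring
  have hlim := (Complex.continuous_re.tendsto _).comp
    ((((hc₁.add hc₂).sub hc₃).sub hc₀).comp tendsto_ofReal_mul_I_cobounded)
  have hnonneg := ge_of_tendsto hlim (b := 0) (by
    filter_upwards [h₃.eventually_mem_diff, eventually_gt_atTop 0] with y hy hy0
    have h1 := mul_nonneg hy0.le (neg_nonneg.2 (key _ hy))
    simp at h1 ⊢
    linarith)
  simp at hnonneg
  linarith
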